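/- arXiv:1912.04976 — 4 statements merged into one kernel-verified Lean document; each statement's English description precedes it below -/
import Mathlib

section
/- Let 𝒯 be a hierarchy on a nonempty finite set X. A subfamily P ⊆ 𝒯 is a partition of X (its members are pairwise disjoint and their union is X) if and only if P satisfies the two vertex-cut constraints: (1) no member of P strictly contains another member of P, and (2) every minimal member (leaf) of 𝒯 is contained in some member of P. -/
variable {α : Type*}

/-- The children of `C` in the family `T`: the maximal members of `T` strictly
contained in `C`. -/
def children [DecidableEq α] (T : Finset (Finset α)) (C : Finset α) :
    Finset (Finset α) :=
  T.filter fun D => D ⊂ C ∧ ∀ E ∈ T, ¬(D ⊂ E ∧ E ⊂ C)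

/-- A hierarchy on a nonempty finite set `X`: a finite laminar family of nonempty
subsets of `X` containing the root `X`, in which the children of every non-minimal
member `C` (the maximal members strictly contained in `C`) form a partition of `C`. -/
structure Hierarchy (α : Type*) [DecidableEq α] (X : Finset α) where
  T : Finset (Finset α)
  root_mem : X ∈ T
  root_nonempty : X.Nonempty
  mem_nonempty : ∀ C ∈ T, C.Nonempty
  mem_subset : ∀ C ∈ T, C ⊆ X
  laminar : ∀ C ∈ T, ∀ D ∈ T, Disjoint C D ∨ C ⊆ D ∨ D ⊆ C
  children_disjoint : ∀ C ∈ T, (∃ D ∈ T, D ⊂ C) →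
    ∀ D₁ ∈ children T C, ∀ D₂ ∈ children T C, D₁ ≠ D₂ → Disjoint D₁ D₂
  children_cover : ∀ C ∈ T, (∃ D ∈ T, D ⊂ C) → (children T C).biUnion id = C

/-- The sub-hierarchy of `T` at `C`: all members of `T` contained in `C`. -/
def subHier [DecidableEq α] (T : Finset (Finset α)) (C : Finset α) :
    Finset (Finset α) :=
  T.filter fun D => D ⊆ C

/-- A tree-consistent segmentation of `C` with respect to the family `T`: a subfamily
`P ⊆ T` whose members are pairwise disjoint and whose union is `C`. -/
def IsSeg [DecidableEq α] (T : Finset (Finset α)) (C : Finset α)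
    (P : Finset (Finset α)) : Prop :=
  P ⊆ T ∧ (∀ D₁ ∈ P, ∀ D₂ ∈ P, D₁ ≠ D₂ → Disjoint D₁ D₂) ∧ P.biUnion id = C

/-- Every point of a member `C` of a hierarchy lies in a minimal member. -/
theorem Hierarchy.exists_minimal_mem [DecidableEq α] {X : Finset α} (H : Hierarchy α X)
    {C : Finset α} (hC : C ∈ H.T) {x : α} (hx : x ∈ C) :
    ∃ L ∈ H.T, (∀ D ∈ H.T, ¬ D ⊂ L) ∧ x ∈ L := by
  induction C using Finset.strongInduction with
  | H C ih =>
    by_cases h : ∃ D ∈ H.T, D ⊂ C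
    · rw [← H.children_cover C hC h, Finset.mem_biUnion] at hx
      obtain ⟨D, hD, hxD⟩ := hx
      obtain ⟨hDT, hDC, -⟩ := Finset.mem_filter.1 hD
      exact ih D hDC hDT hxD
    · exact ⟨C, hC, fun D hD hDC => h ⟨D, hD, hDC⟩, hx⟩

/-- **Tree-consistent segmentations are exactly the vertex cuts.** For a subfamily
`P ⊆ 𝒯` of a hierarchy on a nonempty finite set `X`, `P` is a partition of `X`
(pairwise disjoint members whose union is `X`) iff (1) no member of `P` strictly
contains another member of `P`, and (2) every minimal member (leaf) of `𝒯` is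
contained in some member of `P`. -/
theorem isSeg_iff_vertexCut [DecidableEq α] {X : Finset α} (H : Hierarchy α X)
    (P : Finset (Finset α)) (hP : P ⊆ H.T) :
    ((∀ D₁ ∈ P, ∀ D₂ ∈ P, D₁ ≠ D₂ → Disjoint D₁ D₂) ∧ P.biUnion id = X) ↔
      ((∀ D₁ ∈ P, ∀ D₂ ∈ P, ¬ D₁ ⊂ D₂) ∧
        (∀ L ∈ H.T, (∀ D ∈ H.T, ¬ D ⊂ L) → ∃ C ∈ P, L ⊆ C)) := by
  constructor
  · rintro ⟨hdisj, hcover⟩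
    refine ⟨fun D₁ h₁ D₂ h₂ hlt => ?_, fun L hL hmin => ?_⟩
    · obtain ⟨x, hx⟩ := H.mem_nonempty D₁ (hP h₁)
      exact Finset.disjoint_left.1 (hdisj D₁ h₁ D₂ h₂ hlt.ne) hx (hlt.subset hx)
    · obtain ⟨x, hx⟩ := H.mem_nonempty L hL
      have hxX := H.mem_subset L hL hx
      rw [← hcover, Finset.mem_biUnion] at hxX
      obtain ⟨C, hC, hxC⟩ := hxX
      refine ⟨C, hC, ?_⟩
      rcases H.laminar L hL C (hP hC) with h | h | h
      · exact absurd hxC (Finset.disjoint_left.1 h hx)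
      · exact h
      · by_contra hLC
        exact hmin C (hP hC) ⟨h, hLC⟩
  · rintro ⟨hanti, hleaf⟩
    refine ⟨fun D₁ h₁ D₂ h₂ hne => ?_, Finset.Subset.antisymm ?_ fun x hx => ?_⟩
    · rcases H.laminar D₁ (hP h₁) D₂ (hP h₂) with h | h | h
      · exact h
      · exact absurd (h.ssubset_of_ne hne) (hanti D₁ h₁ D₂ h₂)
      · exact absurd (h.ssubset_of_ne hne.symm) (hanti D₂ h₂ D₁ h₁)
    · exact Finset.biUnion_subset.2 fun D hD => H.mem_subset D (hP hD)
    · obtain ⟨L, hL, hmin, hxL⟩ := H.exists_minimal_mem H.root_mem hx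
      obtain ⟨C, hC, hLC⟩ := hleaf L hL hmin
      exact Finset.mem_biUnion.2 ⟨C, hC, hLC hxL⟩
end

section
/- Let 𝒯 be a hierarchy on a nonempty finite set X, and let f : 𝒯 → ℝ be an arbitrary score function. Define F* : 𝒯 → ℝ by well-founded recursion on strict inclusion: F*(C) = f(C) if C is minimal in 𝒯, and F*(C) = max( f(C), min_i F*(C_i) ) if C has children C₁, …, C_k. Then for every C ∈ 𝒯, F*(C) equals the maximum, over all tree-consistent segmentations P of C with respect to the sub-hierarchy 𝒯|C, of the worst-case score F_min(P) = min_{D ∈ P} f(D). -/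
variable {α : Type*}

/-- The dynamic program of Algorithm 1: `Fstar T f C = f C` if `C` is a leaf, and
`Fstar T f C = max (f C) (minᵢ Fstar T f Cᵢ)` over the children `Cᵢ` of `C`
otherwise; defined by well-founded recursion on strict inclusion (via cardinality). -/
noncomputable def Fstar [DecidableEq α] (T : Finset (Finset α)) (f : Finset α → ℝ) :
    Finset α → ℝ := fun C =>
  if hc : (children T C).Nonempty then
    max (f C)
      ((children T C).attach.inf' (by simpa using hc) fun D => Fstar T f D.1)
  else f C
termination_by C => C.card
decreasing_by
  exact Finset.card_lt_card (Finset.mem_filter.mp D.2).2.1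

theorem le_Fstar_iff [DecidableEq α] (T : Finset (Finset α)) (f : Finset α → ℝ)
    (C : Finset α) (r : ℝ) :
    r ≤ Fstar T f C ↔
      r ≤ f C ∨ (children T C).Nonempty ∧ ∀ D ∈ children T C, r ≤ Fstar T f D := by
  rw [Fstar]
  split_ifs with hc
  · simp [hc, Finset.le_inf'_iff]
  · simp [hc]

theorem mem_children [DecidableEq α] {T : Finset (Finset α)} {C D : Finset α} :
    D ∈ children T C ↔ D ∈ T ∧ D ⊂ C ∧ ∀ E ∈ T, ¬(D ⊂ E ∧ E ⊂ C) := by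
  simp [children]

theorem mem_subHier [DecidableEq α] {T : Finset (Finset α)} {C D : Finset α} :
    D ∈ subHier T C ↔ D ∈ T ∧ D ⊆ C := by
  simp [subHier]

theorem IsSeg.exists_mem [DecidableEq α] {T P : Finset (Finset α)} {C : Finset α}
    (h : IsSeg T C P) {x : α} (hx : x ∈ C) : ∃ D ∈ P, x ∈ D := by
  rw [← h.2.2] at hx
  simpa using hx

theorem IsSeg.nonempty [DecidableEq α] {T P : Finset (Finset α)} {C : Finset α}
    (h : IsSeg T C P) (hC : C.Nonempty) : P.Nonempty := by
  obtain ⟨x, hx⟩ := hC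
  obtain ⟨D, hD, -⟩ := h.exists_mem hx
  exact ⟨D, hD⟩

theorem isSeg_singleton [DecidableEq α] {T : Finset (Finset α)} {C : Finset α}
    (hC : C ∈ T) : IsSeg (subHier T C) C {C} := by
  refine ⟨?_, ?_, by simp⟩
  · simp [mem_subHier, hC]
  · intro D₁ h₁ D₂ h₂ hne
    simp_all

/-- A segmentation of `C` other than `{C}` restricts to a segmentation of each child. -/
theorem Hierarchy.isSeg_filter [DecidableEq α] {X : Finset α} (H : Hierarchy α X)
    {C E : Finset α} {P : Finset (Finset α)} (hP : IsSeg (subHier H.T C) C P)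
    (hCP : C ∉ P) (hE : E ∈ children H.T C) :
    IsSeg (subHier H.T E) E (P.filter fun D => D ⊆ E) := by
  obtain ⟨hET, hEC, hmax⟩ := mem_children.mp hE
  refine ⟨?_, ?_, ?_⟩
  · intro D hD
    obtain ⟨hDP, hDE⟩ := Finset.mem_filter.mp hD
    exact mem_subHier.mpr ⟨(mem_subHier.mp (hP.1 hDP)).1, hDE⟩
  · intro D₁ h₁ D₂ h₂
    exact hP.2.1 D₁ (Finset.mem_filter.mp h₁).1 D₂ (Finset.mem_filter.mp h₂).1
  · apply Finset.Subset.antisymm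
    · intro x hx
      obtain ⟨D, hD, hxD⟩ := Finset.mem_biUnion.mp hx
      exact (Finset.mem_filter.mp hD).2 hxD
    · intro x hx
      obtain ⟨D, hDP, hxD⟩ := hP.exists_mem (hEC.1 hx)
      obtain ⟨hDT, hDC⟩ := mem_subHier.mp (hP.1 hDP)
      have hDC' : D ⊂ C := hDC.ssubset_of_ne (by rintro rfl; exact hCP hDP)
      have hDE : D ⊆ E := by
        rcases H.laminar D hDT E hET with h | h | h
        · exact absurd hx (Finset.disjoint_left.mp h hxD)
        · exact h
        · by_contra hn
          exact hmax D hDT ⟨⟨h, hn⟩, hDC'⟩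
      exact Finset.mem_biUnion.mpr ⟨D, Finset.mem_filter.mpr ⟨hDP, hDE⟩, hxD⟩

/-- Segmentations of the children of a non-minimal `C` combine to a segmentation of `C`. -/
theorem Hierarchy.isSeg_biUnion [DecidableEq α] {X : Finset α} (H : Hierarchy α X)
    {C : Finset α} (hC : C ∈ H.T) (hne : (children H.T C).Nonempty)
    {Q : Finset α → Finset (Finset α)}
    (hQ : ∀ E ∈ children H.T C, IsSeg (subHier H.T E) E (Q E)) :
    IsSeg (subHier H.T C) C ((children H.T C).biUnion Q) := by
  obtain ⟨E₀, hE₀⟩ := hne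
  have hlt : ∃ D ∈ H.T, D ⊂ C :=
    ⟨E₀, (mem_children.mp hE₀).1, (mem_children.mp hE₀).2.1⟩
  refine ⟨?_, ?_, ?_⟩
  · intro D hD
    obtain ⟨E, hE, hDE⟩ := Finset.mem_biUnion.mp hD
    obtain ⟨hDT, hsub⟩ := mem_subHier.mp ((hQ E hE).1 hDE)
    exact mem_subHier.mpr ⟨hDT, hsub.trans (mem_children.mp hE).2.1.1⟩
  · intro D₁ h₁ D₂ h₂ hD
    obtain ⟨E₁, hE₁, hDE₁⟩ := Finset.mem_biUnion.mp h₁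
    obtain ⟨E₂, hE₂, hDE₂⟩ := Finset.mem_biUnion.mp h₂
    by_cases hE : E₁ = E₂
    · subst hE
      exact (hQ E₁ hE₁).2.1 D₁ hDE₁ D₂ hDE₂ hD
    · exact (H.children_disjoint C hC hlt E₁ hE₁ E₂ hE₂ hE).mono
        (mem_subHier.mp ((hQ E₁ hE₁).1 hDE₁)).2 (mem_subHier.mp ((hQ E₂ hE₂).1 hDE₂)).2
  · rw [Finset.biUnion_biUnion]
    exact (Finset.biUnion_congr rfl fun E hE => (hQ E hE).2.2).trans
      (H.children_cover C hC hlt)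

theorem Hierarchy.le_Fstar_iff_exists_isSeg [DecidableEq α] {X : Finset α}
    (H : Hierarchy α X) (f : Finset α → ℝ) (r : ℝ) (C : Finset α) (hC : C ∈ H.T) :
    r ≤ Fstar H.T f C ↔ ∃ P, IsSeg (subHier H.T C) C P ∧ ∀ D ∈ P, r ≤ f D := by
  induction C using Finset.strongInduction with
  | H C ih =>
    rw [le_Fstar_iff]
    constructor
    · rintro (h | ⟨hne, h⟩)
      · exact ⟨{C}, isSeg_singleton hC, by simpa using h⟩
      · have hex : ∀ E, ∃ P, E ∈ children H.T C →
            IsSeg (subHier H.T E) E P ∧ ∀ D ∈ P, r ≤ f D := by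
          intro E
          by_cases hE : E ∈ children H.T C
          · obtain ⟨hET, hEC, -⟩ := mem_children.mp hE
            obtain ⟨P, hP⟩ := (ih E hEC hET).mp (h E hE)
            exact ⟨P, fun _ => hP⟩
          · exact ⟨∅, fun h' => absurd h' hE⟩
        choose Q hQ using hex
        refine ⟨_, H.isSeg_biUnion hC hne fun E hE => (hQ E hE).1, ?_⟩
        intro D hD
        obtain ⟨E, hE, hDE⟩ := Finset.mem_biUnion.mp hD
        exact (hQ E hE).2 D hDE
    · rintro ⟨P, hP, hr⟩
      by_cases hCP : C ∈ P
      · exact Or.inl (hr C hCP)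
      · right
        have hCne := H.mem_nonempty C hC
        constructor
        · obtain ⟨D, hDP⟩ := hP.nonempty hCne
          obtain ⟨hDT, hDC⟩ := mem_subHier.mp (hP.1 hDP)
          have hlt : ∃ D ∈ H.T, D ⊂ C :=
            ⟨D, hDT, hDC.ssubset_of_ne (by rintro rfl; exact hCP hDP)⟩
          rw [← H.children_cover C hC hlt] at hCne
          obtain ⟨x, hx⟩ := hCne
          obtain ⟨E, hE, -⟩ := Finset.mem_biUnion.mp hx
          exact ⟨E, hE⟩
        · intro E hE
          obtain ⟨hET, hEC, -⟩ := mem_children.mp hE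
          exact (ih E hEC hET).mpr ⟨_, H.isSeg_filter hP hCP hE,
            fun D hD => hr D (Finset.mem_filter.mp hD).1⟩

/-- **Theorem 1, value form.** For every member `C` of a hierarchy `𝒯`, the value
`Fstar 𝒯 f C` computed by the dynamic program of Algorithm 1 is the greatest
worst-case score `F_min(P) = min_{D ∈ P} f D` over all tree-consistent segmentations
`P` of `C` with respect to the sub-hierarchy `𝒯|C`. -/
theorem Fstar_isGreatest [DecidableEq α] {X : Finset α} (H : Hierarchy α X)
    (f : Finset α → ℝ) :
    ∀ C ∈ H.T,
      IsGreatest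
        {r : ℝ | ∃ (P : Finset (Finset α)) (hP : P.Nonempty),
          IsSeg (subHier H.T C) C P ∧ r = P.inf' hP f}
        (Fstar H.T f C) := by
  intro C hC
  constructor
  · obtain ⟨P, hP, hr⟩ := (H.le_Fstar_iff_exists_isSeg f _ C hC).mp le_rfl
    have hne := hP.nonempty (H.mem_nonempty C hC)
    refine ⟨P, hne, hP, le_antisymm ((Finset.le_inf'_iff hne f).mpr hr) ?_⟩
    exact (H.le_Fstar_iff_exists_isSeg f _ C hC).mpr
      ⟨P, hP, fun D hD => Finset.inf'_le f hD⟩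
  · rintro _ ⟨P, hne, hP, rfl⟩
    exact (H.le_Fstar_iff_exists_isSeg f _ C hC).mpr
      ⟨P, hP, fun D hD => Finset.inf'_le f hD⟩
end

section
/- Average-case segmentation lacks optimal substructure: there exist a hierarchy 𝒯 on a finite set X, with root X having children C₁ and C₂, and a score function f : 𝒯 → ℝ, such that the tree-consistent segmentation of X maximizing the average score F_avg(P) = (∑_{D∈P} f(D))/|P| is NOT of the form P₁ ∪ P₂ with P_i an optimal average-case segmentation of C_i with respect to the sub-hierarchy 𝒯|C_i. -/
variable {α : Type*}

/-- The average-case score of a segmentation `P`: `F_avg(P) = (∑ D ∈ P, f D) / |P|`. -/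
noncomputable def Favg (f : Finset α → ℝ) (P : Finset (Finset α)) : ℝ :=
  (∑ D ∈ P, f D) / P.card

/-- The root `{0, 1, 2}` with the children `{0, 1}` and `{2}`, the former split into
singletons. -/
def exampleTree : Finset (Finset ℕ) := {{0, 1, 2}, {0, 1}, {0}, {1}, {2}}

/-- The hierarchy carried by `exampleTree`. -/
def exampleHierarchy : Hierarchy ℕ {0, 1, 2} where
  T := exampleTree
  root_mem := by decide
  root_nonempty := by decide
  mem_nonempty := by decide
  mem_subset := by decide
  laminar := by decide
  children_disjoint := by decide
  children_cover := by decide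

/-- Score `11` on `{0, 1}`, `10` on `{0}` and `{1}`, and `0` elsewhere. -/
noncomputable def exampleScore (D : Finset ℕ) : ℝ :=
  if D = {0, 1} then 11 else if D = {0} ∨ D = {1} then 10 else 0

instance IsSeg.decidable {α : Type*} [DecidableEq α] (T : Finset (Finset α))
    (C : Finset α) (P : Finset (Finset α)) : Decidable (IsSeg T C P) :=
  inferInstanceAs (Decidable (_ ∧ _ ∧ _))

theorem exampleScore_root : exampleScore {0, 1, 2} = 0 := by
  rw [exampleScore, if_neg (by decide), if_neg (by decide)]

theorem exampleScore_pair : exampleScore {0, 1} = 11 := by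
  rw [exampleScore, if_pos rfl]

theorem exampleScore_zero : exampleScore {0} = 10 := by
  rw [exampleScore, if_neg (by decide), if_pos (by decide)]

theorem exampleScore_one : exampleScore {1} = 10 := by
  rw [exampleScore, if_neg (by decide), if_pos (by decide)]

theorem exampleScore_two : exampleScore {2} = 0 := by
  rw [exampleScore, if_neg (by decide), if_neg (by decide)]

theorem favg_root : Favg exampleScore {{0, 1, 2}} = 0 := by
  simp [Favg, exampleScore_root]

theorem favg_children : Favg exampleScore {{0, 1}, {2}} = 11 / 2 := by
  rw [Favg, Finset.sum_pair (by decide), exampleScore_pair, exampleScore_two,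
    Finset.card_pair (by decide)]
  norm_num

theorem favg_leaves : Favg exampleScore {{0}, {1}, {2}} = 20 / 3 := by
  rw [Favg, Finset.sum_insert (by decide), Finset.sum_pair (by decide), exampleScore_zero,
    exampleScore_one, exampleScore_two,
    show Finset.card ({{0}, {1}, {2}} : Finset (Finset ℕ)) = 3 by decide]
  norm_num

theorem favg_pair : Favg exampleScore {{0, 1}} = 11 := by
  simp [Favg, exampleScore_pair]

theorem favg_pair_leaves : Favg exampleScore {{0}, {1}} = 10 := by
  rw [Favg, Finset.sum_pair (by decide), exampleScore_zero, exampleScore_one,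
    Finset.card_pair (by decide)]
  norm_num

theorem isSeg_root_cases {P : Finset (Finset ℕ)} (hP : IsSeg exampleTree {0, 1, 2} P) :
    P = {{0, 1, 2}} ∨ P = {{0, 1}, {2}} ∨ P = {{0}, {1}, {2}} := by
  have key : ∀ P ∈ exampleTree.powerset, IsSeg exampleTree {0, 1, 2} P →
      P = {{0, 1, 2}} ∨ P = {{0, 1}, {2}} ∨ P = {{0}, {1}, {2}} := by decide +kernel
  exact key P (Finset.mem_powerset.2 hP.1) hP

theorem isSeg_pair_cases {P : Finset (Finset ℕ)}
    (hP : IsSeg (subHier exampleTree {0, 1}) {0, 1} P) :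
    P = {{0, 1}} ∨ P = {{0}, {1}} := by
  have key : ∀ P ∈ (subHier exampleTree {0, 1}).powerset,
      IsSeg (subHier exampleTree {0, 1}) {0, 1} P →
      P = {{0, 1}} ∨ P = {{0}, {1}} := by decide +kernel
  exact key P (Finset.mem_powerset.2 hP.1) hP

theorem isSeg_leaves : IsSeg exampleTree {0, 1, 2} {{0}, {1}, {2}} := by decide +kernel

theorem isSeg_pair : IsSeg (subHier exampleTree {0, 1}) {0, 1} {{0, 1}} := by
  decide +kernel

/-- **Average-case segmentation lacks optimal substructure** (Figure 3): there are a
hierarchy `𝒯` on a finite set `X` whose root has children `C₁` and `C₂`, and a score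
function `f`, such that an optimal average-case tree-consistent segmentation of `X`
exists, yet no optimal average-case segmentation of `X` is of the form `P₁ ∪ P₂` with
each `Pᵢ` an optimal average-case segmentation of `Cᵢ` w.r.t. the sub-hierarchy
`𝒯|Cᵢ`. -/
theorem avg_no_optimal_substructure :
    ∃ (X : Finset ℕ) (H : Hierarchy ℕ X) (C₁ C₂ : Finset ℕ) (f : Finset ℕ → ℝ),
      children H.T X = {C₁, C₂} ∧ C₁ ≠ C₂ ∧
      (∃ P : Finset (Finset ℕ), IsSeg H.T X P ∧
        ∀ P' : Finset (Finset ℕ), IsSeg H.T X P' → Favg f P' ≤ Favg f P) ∧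
      (∀ P : Finset (Finset ℕ), IsSeg H.T X P →
        (∀ P' : Finset (Finset ℕ), IsSeg H.T X P' → Favg f P' ≤ Favg f P) →
        ∀ P₁ P₂ : Finset (Finset ℕ),
          (IsSeg (subHier H.T C₁) C₁ P₁ ∧
            ∀ Q : Finset (Finset ℕ), IsSeg (subHier H.T C₁) C₁ Q →
              Favg f Q ≤ Favg f P₁) →
          (IsSeg (subHier H.T C₂) C₂ P₂ ∧
            ∀ Q : Finset (Finset ℕ), IsSeg (subHier H.T C₂) C₂ Q →
              Favg f Q ≤ Favg f P₂) →
          P ≠ P₁ ∪ P₂) := by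
  refine ⟨{0, 1, 2}, exampleHierarchy, {0, 1}, {2}, exampleScore, by decide, by decide,
    ⟨{{0}, {1}, {2}}, isSeg_leaves, ?_⟩, ?_⟩
  · intro P' hP'
    rcases isSeg_root_cases hP' with rfl | rfl | rfl
    · rw [favg_root, favg_leaves]; norm_num
    · rw [favg_children, favg_leaves]; norm_num
    · exact le_rfl
  · rintro P hP hopt P₁ P₂ ⟨hP₁, hopt₁⟩ - hunion
    have hleaves : P = {{0}, {1}, {2}} := by
      have h := hopt _ isSeg_leaves
      rcases isSeg_root_cases hP with rfl | rfl | rfl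
      · rw [favg_root, favg_leaves] at h; norm_num at h
      · rw [favg_children, favg_leaves] at h; norm_num at h
      · rfl
    have hpair : P₁ = {{0, 1}} := by
      have h := hopt₁ _ isSeg_pair
      rcases isSeg_pair_cases hP₁ with rfl | rfl
      · rfl
      · rw [favg_pair, favg_pair_leaves] at h; norm_num at h
    have hmem : ({0, 1} : Finset ℕ) ∈ P := by
      rw [hunion, hpair]
      exact Finset.mem_union_left _ (Finset.mem_singleton_self _)
    rw [hleaves] at hmem
    exact absurd hmem (by decide)
end

section
/- Let 𝒯 be a hierarchy on a nonempty finite set X and f : 𝒯 → ℝ a score function, and let F* : 𝒯 → ℝ be defined by F*(C) = f(C) for minimal C and F*(C) = max( f(C), min_i F*(C_i) ) over the children C_i of C otherwise. Then for every C ∈ 𝒯, F*(C) ≥ f(C), and F*(C) ≥ min_{D ∈ P} f(D) for every tree-consistent segmentation P of C with respect to 𝒯|C. -/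
variable {α : Type*}

theorem le_Fstar [DecidableEq α] (T : Finset (Finset α)) (f : Finset α → ℝ) (C : Finset α) :
    f C ≤ Fstar T f C := by
  rw [Fstar]
  split_ifs
  · exact le_max_left _ _
  · exact le_rfl

theorem le_Fstar_of_forall_children [DecidableEq α] {T : Finset (Finset α)}
    {f : Finset α → ℝ} {C : Finset α} {a : ℝ} (hC : (children T C).Nonempty)
    (h : ∀ E ∈ children T C, a ≤ Fstar T f E) : a ≤ Fstar T f C := by
  rw [Fstar, dif_pos hC]
  exact le_max_of_le_right (Finset.le_inf' _ _ fun E _ => h E.1 E.2)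

namespace Hierarchy

variable [DecidableEq α] {X : Finset α} (H : Hierarchy α X) {C D : Finset α}

/-- A proper descendant of `C` that meets a child of `C` is contained in it. -/
theorem subset_child_of_mem {E : Finset α} (hE : E ∈ children H.T C)
    (hD : D ∈ H.T) (hDC : D ⊂ C) {x : α} (hxD : x ∈ D) (hxE : x ∈ E) : D ⊆ E := by
  obtain ⟨hET, -, hmax⟩ := Finset.mem_filter.mp hE
  rcases H.laminar D hD E hET with h | h | h
  · exact absurd hxE (Finset.disjoint_left.mp h hxD)
  · exact h
  · by_contra hDE
    exact hmax D hD ⟨⟨h, hDE⟩, hDC⟩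

/-- A segmentation of `C` not containing `C` restricts to a segmentation of each child. -/
theorem isSeg_filter_subset_child {P : Finset (Finset α)} (hP : IsSeg (subHier H.T C) C P)
    (hCP : C ∉ P) {E : Finset α} (hE : E ∈ children H.T C) :
    IsSeg (subHier H.T E) E (P.filter (· ⊆ E)) := by
  obtain ⟨hsub, hdisj, hcover⟩ := hP
  refine ⟨fun D hD => ?_, fun D₁ h₁ D₂ h₂ => ?_, ?_⟩
  · obtain ⟨hDP, hDE⟩ := Finset.mem_filter.mp hD
    exact Finset.mem_filter.mpr ⟨(Finset.mem_filter.mp (hsub hDP)).1, hDE⟩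
  · exact hdisj D₁ (Finset.mem_filter.mp h₁).1 D₂ (Finset.mem_filter.mp h₂).1
  · refine Finset.Subset.antisymm
      (Finset.biUnion_subset.mpr fun D hD => (Finset.mem_filter.mp hD).2) fun x hxE => ?_
    have hxC : x ∈ P.biUnion id := hcover ▸ (Finset.mem_filter.mp hE).2.1.1 hxE
    obtain ⟨D, hDP, hxD⟩ := Finset.mem_biUnion.mp hxC
    obtain ⟨hDT, hDC⟩ := Finset.mem_filter.mp (hsub hDP)
    have hss : D ⊂ C := hDC.ssubset_of_ne fun h => hCP (h ▸ hDP)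
    exact Finset.mem_biUnion.mpr
      ⟨D, Finset.mem_filter.mpr ⟨hDP, H.subset_child_of_mem hE hDT hss hxD hxE⟩, hxD⟩

theorem children_nonempty (hC : C ∈ H.T) (hD : D ∈ H.T) (hDC : D ⊂ C) :
    (children H.T C).Nonempty := by
  obtain ⟨x, hx⟩ := H.mem_nonempty C hC
  rw [← H.children_cover C hC ⟨D, hD, hDC⟩] at hx
  obtain ⟨E, hE, -⟩ := Finset.mem_biUnion.mp hx
  exact ⟨E, hE⟩

theorem inf'_le_Fstar (f : Finset α → ℝ) (hC : C ∈ H.T) {P : Finset (Finset α)}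
    (hP : P.Nonempty) (hseg : IsSeg (subHier H.T C) C P) : P.inf' hP f ≤ Fstar H.T f C := by
  induction C using Finset.strongInduction generalizing P with
  | H C ih =>
    by_cases hCP : C ∈ P
    · exact (Finset.inf'_le f hCP).trans (le_Fstar H.T f C)
    · obtain ⟨D, hDP⟩ := id hP
      obtain ⟨hDT, hDC⟩ := Finset.mem_filter.mp (hseg.1 hDP)
      have hss : D ⊂ C := hDC.ssubset_of_ne fun h => hCP (h ▸ hDP)
      refine le_Fstar_of_forall_children (H.children_nonempty hC hDT hss) fun E hE => ?_
      obtain ⟨hET, hEC, -⟩ := Finset.mem_filter.mp hE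
      have hsegE := H.isSeg_filter_subset_child hseg hCP hE
      have hne : (P.filter (· ⊆ E)).Nonempty := by
        obtain ⟨x, hx⟩ := H.mem_nonempty E hET
        rw [← hsegE.2.2] at hx
        obtain ⟨D', hD', -⟩ := Finset.mem_biUnion.mp hx
        exact ⟨D', hD'⟩
      exact (Finset.inf'_mono f (Finset.filter_subset _ _) hne).trans (ih E hEC hET hne hsegE)

end Hierarchy

/-- **Upper-bound half of Theorem 1.** For every member `C` of a hierarchy `𝒯`, the
value `Fstar 𝒯 f C` computed by the dynamic program dominates `f C`, and dominates the
worst-case score `min_{D ∈ P} f D` of every tree-consistent segmentation `P` of `C`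
with respect to the sub-hierarchy `𝒯|C`. -/
theorem Fstar_dominates [DecidableEq α] {X : Finset α} (H : Hierarchy α X)
    (f : Finset α → ℝ) :
    ∀ C ∈ H.T,
      f C ≤ Fstar H.T f C ∧
      ∀ (P : Finset (Finset α)) (hP : P.Nonempty),
        IsSeg (subHier H.T C) C P → P.inf' hP f ≤ Fstar H.T f C := by
  exact fun C hC => ⟨le_Fstar H.T f C, fun _ hP hseg => H.inf'_le_Fstar f hC hP hseg⟩
end
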